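/- Well-definedness of the intersection number: let L1, L2 be continuous paths of Lagrangian subspaces of a real symplectic vector space (E, ω) on [a,b]. If (a = t_0 ≤ … ≤ t_k = b; M_1,…,M_k) and (a = t_0' ≤ … ≤ t_{k'}' = b; M_1',…,M_{k'}') are two sets of admissible data for (L1, L2), then (1/2) Σ_{ν=1}^{k} ( s(L1(t_{ν−1}), L2(t_{ν−1}), M_ν) − s(L1(t_ν), L2(t_ν), M_ν) ) = (1/2) Σ_{ν=1}^{k'} ( s(L1(t_{ν−1}'), L2(t_{ν−1}'), M_ν') − s(L1(t_ν'), L2(t_ν'), M_ν') ). -/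

import Mathlib

open LinearMap (BilinForm)

variable {E : Type*} [NormedAddCommGroup E] [NormedSpace ℝ E]

/-- A subspace is Lagrangian iff it equals its symplectic orthogonal. -/
def IsLagrangian (ω : BilinForm ℝ E) (L : Submodule ℝ E) : Prop :=
  LinearMap.BilinForm.orthogonal ω L = L

/-- Maximal dimension of a subspace on which the function `Q` is positive away from `0`. -/
noncomputable def posIndex {V : Type*} [AddCommGroup V] [Module ℝ V] (Q : V → ℝ) : ℕ :=
  sSup {d : ℕ | ∃ W : Submodule ℝ V, Module.finrank ℝ W = d ∧ ∀ x ∈ W, x ≠ 0 → 0 < Q x}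

/-- The quadratic form `Q(L1,L2,L3)` of a triplet of subspaces,
`Q(x1,x2,x3) = ω(x1,x2) + ω(x2,x3) + ω(x3,x1)`. -/
def tripleQ (ω : BilinForm ℝ E) (L1 L2 L3 : Submodule ℝ E) (v : L1 × L2 × L3) : ℝ :=
  ω v.1 v.2.1 + ω v.2.1 v.2.2 + ω v.2.2 v.1

/-- The signature `s(L1,L2,L3)` of a triplet of subspaces: the signature (number of positive
squares minus number of negative squares in a diagonalization) of `Q(L1,L2,L3)`. -/
noncomputable def tripleSig (ω : BilinForm ℝ E) (L1 L2 L3 : Submodule ℝ E) : ℤ :=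
  (posIndex (tripleQ ω L1 L2 L3) : ℤ) - (posIndex (fun v => - tripleQ ω L1 L2 L3 v) : ℤ)

/-- A continuous path of Lagrangian subspaces of `(E, ω)` on the interval `[a,b]`:  a family
`(L t)` of Lagrangian subspaces such that every `t0 ∈ [a,b]` has a neighbourhood `U` in `[a,b]`
on which there is a continuous family of idempotent linear maps of `E` with range `L t`. -/
structure IsLagrangianPath (ω : BilinForm ℝ E) (a b : ℝ) (L : ℝ → Submodule ℝ E) : Prop where
  lag : ∀ t ∈ Set.Icc a b, IsLagrangian ω (L t)
  locTriv : ∀ t0 ∈ Set.Icc a b, ∃ U ∈ nhdsWithin t0 (Set.Icc a b), U ⊆ Set.Icc a b ∧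
    ∃ P : ℝ → E →L[ℝ] E, ContinuousOn P U ∧
      ∀ t ∈ U, (P t).comp (P t) = P t ∧ LinearMap.range (P t : E →ₗ[ℝ] E) = L t

/-- A jointly continuous two-parameter family `(L s t)`, `s ∈ [0,1]`, `t ∈ [a,b]`, of Lagrangian
subspaces (a homotopy of paths of Lagrangian subspaces). -/
structure IsLagrangianHomotopy (ω : BilinForm ℝ E) (a b : ℝ)
    (L : ℝ → ℝ → Submodule ℝ E) : Prop where
  lag : ∀ s ∈ Set.Icc (0:ℝ) 1, ∀ t ∈ Set.Icc a b, IsLagrangian ω (L s t)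
  locTriv : ∀ p ∈ Set.Icc (0:ℝ) 1 ×ˢ Set.Icc a b,
    ∃ U ∈ nhdsWithin p (Set.Icc (0:ℝ) 1 ×ˢ Set.Icc a b),
      U ⊆ Set.Icc (0:ℝ) 1 ×ˢ Set.Icc a b ∧
      ∃ P : ℝ × ℝ → E →L[ℝ] E, ContinuousOn P U ∧
        ∀ q ∈ U, (P q).comp (P q) = P q ∧ LinearMap.range (P q : E →ₗ[ℝ] E) = L q.1 q.2

/-- Admissible data for a pair of paths of Lagrangian subspaces on `[a,b]`:  a partition
`a = t_0 ≤ t_1 ≤ … ≤ t_k = b` together with Lagrangian subspaces `M_1, …, M_k` such that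
`M_ν ∩ L_i(t) = 0` for all `t ∈ [t_{ν-1}, t_ν]`, `i = 1,2`.  (Here `M (ν+1)` plays the role
of `M_{ν+1}` for `0 ≤ ν < k`.) -/
structure AdmissibleData (ω : BilinForm ℝ E) (a b : ℝ) (L1 L2 : ℝ → Submodule ℝ E) where
  k : ℕ
  kpos : 0 < k
  t : ℕ → ℝ
  M : ℕ → Submodule ℝ E
  ht0 : t 0 = a
  htk : t k = b
  hmono : ∀ ν < k, t ν ≤ t (ν + 1)
  hlag : ∀ ν < k, IsLagrangian ω (M (ν + 1))
  htrans1 : ∀ ν < k, ∀ s ∈ Set.Icc (t ν) (t (ν + 1)), M (ν + 1) ⊓ L1 s = ⊥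
  htrans2 : ∀ ν < k, ∀ s ∈ Set.Icc (t ν) (t (ν + 1)), M (ν + 1) ⊓ L2 s = ⊥

/-- The expression `(1/2) Σ_ν ( s(L1(t_{ν-1}), L2(t_{ν-1}), M_ν) − s(L1(t_ν), L2(t_ν), M_ν) )`
computed from admissible data; by well-definedness this is the intersection number `[L1 : L2]`. -/
noncomputable def dataSum {ω : BilinForm ℝ E} {a b : ℝ} {L1 L2 : ℝ → Submodule ℝ E}
    (D : AdmissibleData ω a b L1 L2) : ℝ :=
  (1 / 2 : ℝ) * ∑ ν ∈ Finset.range D.k,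
    ((tripleSig ω (L1 (D.t ν)) (L2 (D.t ν)) (D.M (ν + 1)) : ℝ)
      - (tripleSig ω (L1 (D.t (ν + 1))) (L2 (D.t (ν + 1))) (D.M (ν + 1)) : ℝ))

/-- A continuous path of symplectic automorphisms of `(E, ω)` on `[a,b]`. -/
structure IsSymplecticPath (ω : BilinForm ℝ E) (a b : ℝ) (A : ℝ → E →L[ℝ] E) : Prop where
  bij : ∀ t ∈ Set.Icc a b, Function.Bijective (A t)
  symp : ∀ t ∈ Set.Icc a b, ∀ x y, ω (A t x) (A t y) = ω x y
  cont : ContinuousOn A (Set.Icc a b)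

/-- The symplectic form of `E × E⁻`: `((x1,x2),(y1,y2)) ↦ ω(x1,y1) − ω(x2,y2)`. -/
noncomputable def prodNegForm (ω : BilinForm ℝ E) : BilinForm ℝ (E × E) :=
  LinearMap.mk₂ ℝ (fun x y => ω x.1 y.1 - ω x.2 y.2)
    (fun x x' y => by simp only [Prod.fst_add, Prod.snd_add, map_add, LinearMap.add_apply]; ring)
    (fun c x y => by
      simp only [Prod.smul_fst, Prod.smul_snd, map_smul, LinearMap.smul_apply, smul_eq_mul]; ring)
    (fun x y y' => by simp only [Prod.fst_add, Prod.snd_add, map_add]; ring)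
    (fun c x y => by simp only [Prod.smul_fst, Prod.smul_snd, map_smul, smul_eq_mul]; ring)

/-- The graph `Γ_A = {(A x, x)}` of an endomorphism, as a subspace of `E × E`. -/
def graphSub (A : E →L[ℝ] E) : Submodule ℝ (E × E) :=
  LinearMap.range ((A : E →ₗ[ℝ] E).prod LinearMap.id)

/-- The diagonal `Δ = {(x, x)}` in `E × E`. -/
def diagSub : Submodule ℝ (E × E) :=
  LinearMap.range ((LinearMap.id : E →ₗ[ℝ] E).prod LinearMap.id)

open Filter Topology QuadraticForm

/-- The signature of a real quadratic form. -/
noncomputable def formSig {V : Type*} [AddCommGroup V] [Module ℝ V] (Q : QuadraticForm ℝ V) : ℤ :=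
  (sigPos Q : ℤ) - (sigNeg Q : ℤ)

section Signature

variable {V W : Type*} [AddCommGroup V] [Module ℝ V] [AddCommGroup W] [Module ℝ W]

lemma posIndex_eq_sigPos [FiniteDimensional ℝ V] (Q : QuadraticForm ℝ V) :
    posIndex (fun x => Q x) = sigPos Q := by
  have h : {d : ℕ | ∃ W : Submodule ℝ V, Module.finrank ℝ W = d ∧ ∀ x ∈ W, x ≠ 0 → 0 < Q x} =
      {d : ℕ | ∃ W : Submodule ℝ V, Module.finrank ℝ W = d ∧ (Q.restrict W).PosDef} := by
    ext d
    simp [QuadraticMap.PosDef]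
  rw [posIndex, h]
  exact (sigPos_isGreatest Q).csSup_eq

lemma formSig_congr {Q : QuadraticForm ℝ V} {Q' : QuadraticForm ℝ W} (e : V ≃ₗ[ℝ] W)
    (he : ∀ x, Q' (e x) = Q x) : formSig Q = formSig Q' := by
  have h : Q.Equivalent Q' := ⟨{ e with map_app' := he }⟩
  rw [formSig, formSig, h.sigPos_eq, h.sigNeg_eq]

lemma formSig_neg (Q : QuadraticForm ℝ V) : formSig (-Q) = -formSig Q := by
  rw [formSig, formSig, sigPos_neg, sigNeg_neg, neg_sub]

lemma radical_prod (Q : QuadraticForm ℝ V) (R : QuadraticForm ℝ W) :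
    (Q.prod R).radical = Q.radical.prod R.radical := by
  simp only [QuadraticMap.radical_eq_ker_polarBilin]
  ext ⟨x, y⟩
  simp only [LinearMap.mem_ker, Submodule.mem_prod, LinearMap.ext_iff, Prod.forall,
    QuadraticMap.polarBilin_apply_apply, QuadraticMap.polar_prod, LinearMap.zero_apply]
  constructor
  · intro h
    exact ⟨fun a => by simpa using h a 0, fun b => by simpa using h 0 b⟩
  · rintro ⟨h1, h2⟩ a b
    rw [h1, h2, add_zero]

variable [FiniteDimensional ℝ V] [FiniteDimensional ℝ W]

lemma finrank_submodule_prod (A : Submodule ℝ V) (B : Submodule ℝ W) :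
    Module.finrank ℝ (A.prod B) = Module.finrank ℝ A + Module.finrank ℝ B := by
  have h : A.prod B = LinearMap.range (A.subtype.prodMap B.subtype) := by
    rw [LinearMap.range_prodMap, A.range_subtype, B.range_subtype]
  rw [h, LinearMap.finrank_range_of_inj, Module.finrank_prod]
  exact A.injective_subtype.prodMap B.injective_subtype

lemma sigPos_add_le_sigPos_prod (Q : QuadraticForm ℝ V) (R : QuadraticForm ℝ W) :
    sigPos Q + sigPos R ≤ sigPos (Q.prod R) := by
  obtain ⟨A, hA, hQ⟩ := exists_finrank_eq_sigPos_and_posDef Q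
  obtain ⟨B, hB, hR⟩ := exists_finrank_eq_sigPos_and_posDef R
  have key : ((Q.prod R).restrict (A.prod B)).PosDef := by
    rintro ⟨⟨x, y⟩, hx, hy⟩ hne
    have hQ' : ∀ z ∈ A, z ≠ 0 → 0 < Q z := fun z hz h => hQ ⟨z, hz⟩ (by simpa using h)
    have hR' : ∀ z ∈ B, z ≠ 0 → 0 < R z := fun z hz h => hR ⟨z, hz⟩ (by simpa using h)
    have hx' : x ∈ A := hx
    have hy' : y ∈ B := hy
    change 0 < Q x + R y
    by_cases hx0 : x = 0
    · have hy0 : y ≠ 0 := by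
        rintro rfl
        exact hne (by simp [hx0])
      simpa [hx0] using hR' y hy' hy0
    · by_cases hy0 : y = 0
      · simpa [hy0] using hQ' x hx' hx0
      · exact add_pos (hQ' x hx' hx0) (hR' y hy' hy0)
  rw [← hA, ← hB, ← finrank_submodule_prod]
  exact le_sigPos_of_posDef _ key

lemma formSig_prod (Q : QuadraticForm ℝ V) (R : QuadraticForm ℝ W) :
    formSig (Q.prod R) = formSig Q + formSig R := by
  have h1 := sigPos_add_le_sigPos_prod Q R
  have h2 := sigPos_add_le_sigPos_prod (-Q) (-R)
  have h3 : (-Q).prod (-R) = -(Q.prod R) := by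
    ext x
    simp [add_comm]
  rw [h3, sigPos_neg, sigPos_neg, sigPos_neg] at h2
  have hQ := sigPos_add_sigNeg_add_radical (Q := Q)
  have hR := sigPos_add_sigNeg_add_radical (Q := R)
  have hQR := sigPos_add_sigNeg_add_radical (Q := Q.prod R)
  rw [radical_prod, finrank_submodule_prod, Module.finrank_prod] at hQR
  unfold formSig
  omega

end Signature

section Semicontinuity

variable {V : Type*} [NormedAddCommGroup V] [NormedSpace ℝ V] [FiniteDimensional ℝ V]

lemma eventually_sigPos_le {s : Set ℝ} {t₀ : ℝ} (Q : ℝ → QuadraticForm ℝ V)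
    (hQ : ∀ x, Tendsto (fun z : ℝ × V => Q z.1 z.2) (𝓝[s] t₀ ×ˢ 𝓝 x) (𝓝 (Q t₀ x))) :
    ∀ᶠ t in 𝓝[s] t₀, sigPos (Q t₀) ≤ sigPos (Q t) := by
  obtain ⟨A, hA, hpos⟩ := exists_finrank_eq_sigPos_and_posDef (Q t₀)
  have hK : IsCompact ((A : Set V) ∩ Metric.sphere 0 1) :=
    have := FiniteDimensional.proper ℝ V
    (isCompact_sphere 0 1).inter_left A.closed_of_finiteDimensional
  have key : ∀ᶠ t in 𝓝[s] t₀, ∀ x ∈ (A : Set V) ∩ Metric.sphere 0 1, 0 < Q t x := by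
    refine hK.induction_on (p := fun S => ∀ᶠ t in 𝓝[s] t₀, ∀ x ∈ S, 0 < Q t x) ?_ ?_ ?_ ?_
    · simp
    · intro S T hST hT
      filter_upwards [hT] with t ht x hx using ht x (hST hx)
    · intro S T hS hT
      filter_upwards [hS, hT] with t h1 h2 x hx using hx.elim (h1 x) (h2 x)
    · rintro x ⟨hxA, hx⟩
      have hx0 : x ≠ 0 := by
        rintro rfl
        simp at hx
      have hQx : 0 < Q t₀ x := hpos ⟨x, hxA⟩ (by simpa using hx0)
      obtain ⟨pa, hpa, pb, hpb, h⟩ := eventually_prod_iff.1 ((hQ x).eventually_const_lt hQx)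
      refine ⟨{y | pb y}, mem_nhdsWithin_of_mem_nhds hpb, ?_⟩
      filter_upwards [hpa] with t ht y hy using h ht hy
  filter_upwards [key] with t ht
  rw [← hA]
  refine le_sigPos_of_posDef _ ?_
  rintro ⟨x, hx⟩ hne
  have hx0 : ‖x‖ ≠ 0 := by simpa using hne
  have h := ht (‖x‖⁻¹ • x) ⟨A.smul_mem _ hx, by simp [norm_smul, hx0]⟩
  rw [QuadraticMap.map_smul, smul_eq_mul] at h
  exact (pos_iff_pos_of_mul_pos h).1 (by positivity)

lemma eventually_formSig_eq {s : Set ℝ} {t₀ : ℝ} (Q : ℝ → QuadraticForm ℝ V)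
    (hQ : ∀ x, Tendsto (fun z : ℝ × V => Q z.1 z.2) (𝓝[s] t₀ ×ˢ 𝓝 x) (𝓝 (Q t₀ x)))
    (hrad : ∀ t ∈ s, (Q t).radical = (Q t₀).radical) :
    ∀ᶠ t in 𝓝[s] t₀, formSig (Q t) = formSig (Q t₀) := by
  filter_upwards [eventually_sigPos_le Q hQ,
    eventually_sigPos_le (fun t => -Q t) (fun x => (hQ x).neg), self_mem_nhdsWithin] with t h1 h2 ht
  rw [sigPos_neg, sigPos_neg] at h2
  have h3 := sigPos_add_sigNeg_add_radical (Q := Q t)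
  have h4 := sigPos_add_sigNeg_add_radical (Q := Q t₀)
  rw [hrad t ht] at h3
  unfold formSig
  omega

lemma formSig_const {u v : ℝ} (huv : u ≤ v) (Q : ℝ → QuadraticForm ℝ V)
    (hQ : ∀ t₀ ∈ Set.Icc u v, ∀ x,
      Tendsto (fun z : ℝ × V => Q z.1 z.2) (𝓝[Set.Icc u v] t₀ ×ˢ 𝓝 x) (𝓝 (Q t₀ x)))
    (hrad : ∀ t ∈ Set.Icc u v, ∀ t' ∈ Set.Icc u v, (Q t).radical = (Q t').radical) :
    formSig (Q u) = formSig (Q v) := by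
  refine isPreconnected_Icc.constant (f := fun t => formSig (Q t)) (s := Set.Icc u v) ?_
    (Set.left_mem_Icc.2 huv) (Set.right_mem_Icc.2 huv)
  intro t ht
  exact tendsto_const_nhds.congr'
    ((eventually_formSig_eq Q (hQ t ht) fun t' ht' => hrad t' ht' t ht).mono fun _ h => h.symm)

end Semicontinuity

section Triple

/-- The quadratic form `tripleQ ω A X M`. -/
noncomputable def tripleForm (ω : BilinForm ℝ E) (A X M : Submodule ℝ E) :
    QuadraticForm ℝ (A × X × M) :=
  let π₁ : A × X × M →ₗ[ℝ] E := A.subtype ∘ₗ LinearMap.fst ℝ A (X × M)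
  let π₂ : A × X × M →ₗ[ℝ] E := X.subtype ∘ₗ LinearMap.fst ℝ X M ∘ₗ LinearMap.snd ℝ A (X × M)
  let π₃ : A × X × M →ₗ[ℝ] E := M.subtype ∘ₗ LinearMap.snd ℝ X M ∘ₗ LinearMap.snd ℝ A (X × M)
  LinearMap.BilinMap.toQuadraticMap
    (ω.compl₁₂ π₁ π₂ + ω.compl₁₂ π₂ π₃ + ω.compl₁₂ π₃ π₁)

lemma tripleForm_apply (ω : BilinForm ℝ E) (A X M : Submodule ℝ E) (v : A × X × M) :
    tripleForm ω A X M v = tripleQ ω A X M v := rfl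

/-- The quadratic form `x ↦ ω (p x) x` on a subspace `X`. -/
noncomputable def restrictForm (ω : BilinForm ℝ E) (p : E →ₗ[ℝ] E) (X : Submodule ℝ E) :
    QuadraticForm ℝ X :=
  LinearMap.BilinMap.toQuadraticMap (ω.compl₁₂ (p ∘ₗ X.subtype) X.subtype)

lemma restrictForm_apply (ω : BilinForm ℝ E) (p : E →ₗ[ℝ] E) (X : Submodule ℝ E) (x : X) :
    restrictForm ω p X x = ω (p x) x := rfl

/-- The quadratic form `(a, m) ↦ ω a m` on the product of two subspaces. -/
noncomputable def pairingForm (ω : BilinForm ℝ E) (A M : Submodule ℝ E) :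
    QuadraticForm ℝ (A × M) :=
  LinearMap.BilinMap.toQuadraticMap
    (ω.compl₁₂ (A.subtype ∘ₗ LinearMap.fst ℝ A M) (M.subtype ∘ₗ LinearMap.snd ℝ A M))

lemma pairingForm_apply (ω : BilinForm ℝ E) (A M : Submodule ℝ E) (v : A × M) :
    pairingForm ω A M v = ω v.1 v.2 := rfl

lemma formSig_pairingForm (ω : BilinForm ℝ E) (A M : Submodule ℝ E) :
    formSig (pairingForm ω A M) = 0 := by
  have h : formSig (pairingForm ω A M) = formSig (-pairingForm ω A M) :=
    formSig_congr ((LinearEquiv.neg ℝ).prodCongr (LinearEquiv.refl ℝ M)) fun v => by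
      simp [pairingForm_apply]
  rw [formSig_neg] at h
  omega

variable [FiniteDimensional ℝ E]

lemma tripleSig_eq_formSig (ω : BilinForm ℝ E) (A X M : Submodule ℝ E) :
    tripleSig ω A X M = formSig (tripleForm ω A X M) := by
  have h1 := posIndex_eq_sigPos (tripleForm ω A X M)
  have h2 := posIndex_eq_sigPos (-tripleForm ω A X M)
  rw [sigPos_neg] at h2
  rw [formSig, ← h1, ← h2]
  rfl

/-- Splitting off a hyperbolic summand from `tripleForm ω A X M` when `A` and `M` are
complementary isotropic subspaces. -/
lemma tripleSig_eq_formSig_restrictForm {ω : BilinForm ℝ E} (halt : LinearMap.IsAlt ω)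
    {A M : Submodule ℝ E} (X : Submodule ℝ E) (hA : ∀ x ∈ A, ∀ y ∈ A, ω x y = 0)
    (hM : ∀ x ∈ M, ∀ y ∈ M, ω x y = 0) (h : IsCompl A M) :
    tripleSig ω A X M = formSig (restrictForm ω (A.projection M h) X) := by
  set p := A.projectionOnto M h ∘ₗ X.subtype with hp
  set r := M.projectionOnto A h.symm ∘ₗ X.subtype with hr
  have hpr : ∀ x : X, (x : E) = p x + r x := fun x => by
    exact (Submodule.projection_add_projection_eq_self h (x : E)).symm
  let e : (A × X × M) ≃ₗ[ℝ] (A × M) × X :=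
    { toFun := fun v => ((v.1 - p v.2.1, r v.2.1 - v.2.2), v.2.1)
      invFun := fun w => (w.1.1 + p w.2, w.2, r w.2 - w.1.2)
      map_add' := fun v w => by
        ext <;> simp <;> abel
      map_smul' := fun c v => by
        ext <;> simp [smul_sub]
      left_inv := fun v => by simp
      right_inv := fun v => by simp }
  rw [tripleSig_eq_formSig, formSig_congr (Q' := (pairingForm ω A M).prod
    (restrictForm ω (A.projection M h) X)) e, formSig_prod, formSig_pairingForm, zero_add]
  rintro ⟨a, x, m⟩
  have hx : (A.projection M h) x = p x := rfl
  have he : e (a, x, m) = ((a - p x, r x - m), x) := rfl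
  rw [QuadraticMap.prod_apply, pairingForm_apply, restrictForm_apply, tripleForm_apply, tripleQ,
    he, hx]
  simp only [Submodule.coe_sub]
  rw [hpr x]
  have h1 := hA a a.2 (p x) (p x).2
  have h2 := hA (p x) (p x).2 (p x) (p x).2
  have h3 := hM (r x) (r x).2 m m.2
  have h4 := halt.neg m a
  simp only [map_add, map_sub, LinearMap.add_apply, LinearMap.sub_apply]
  linarith

end Triple

section Lagrangian

lemma IsLagrangian.apply_eq_zero {ω : BilinForm ℝ E} {L : Submodule ℝ E} (hL : IsLagrangian ω L) :
    ∀ x ∈ L, ∀ y ∈ L, ω x y = 0 := by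
  intro x hx y hy
  rw [← hL, LinearMap.BilinForm.mem_orthogonal_iff] at hy
  exact hy x hx

lemma IsLagrangian.mem_of_apply_eq_zero {ω : BilinForm ℝ E} {L : Submodule ℝ E}
    (hL : IsLagrangian ω L) {y : E} (hy : ∀ x ∈ L, ω x y = 0) : y ∈ L := by
  rw [← hL, LinearMap.BilinForm.mem_orthogonal_iff]
  exact hy

lemma shear_identity {ω : BilinForm ℝ E} (halt : LinearMap.IsAlt ω) {A M : Submodule ℝ E}
    (hA : IsLagrangian ω A) (hM : IsLagrangian ω M) {xa ma wa xb mb zb : E}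
    (hxa : xa ∈ A) (hma : ma ∈ A) (hwa : wa ∈ A) (hxb : xb ∈ M) (hmb : mb ∈ M) (hzb : zb ∈ M)
    (hxz : ω (xa + xb) (ma + zb) = 0) (hmw : ω (ma + mb) (wa + xb) = 0) :
    ω (xa + ma) (xa + xb + (ma + zb)) + ω (ma + zb) (ma + mb) =
      ω (ma + wa) (ma + mb + (wa + xb)) + ω (xa + xb - (wa + xb)) (xa + xb) := by
  have hA' := hA.apply_eq_zero
  have hM' := hM.apply_eq_zero
  simp only [map_add, map_sub, LinearMap.add_apply, LinearMap.sub_apply, hA' xa hxa xa hxa,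
    hA' xa hxa ma hma, hA' ma hma xa hxa, hA' ma hma ma hma, hA' ma hma wa hwa, hA' wa hwa ma hma,
    hA' wa hwa wa hwa, hA' wa hwa xa hxa, hM' xb hxb zb hzb, hM' mb hmb xb hxb, hM' zb hzb mb hmb,
    hM' xb hxb xb hxb] at hxz hmw ⊢
  linarith [halt.neg ma zb, halt.neg xb ma, halt.neg mb wa]

lemma radical_restrictForm {ω : BilinForm ℝ E} (halt : LinearMap.IsAlt ω)
    {A M M' : Submodule ℝ E} (hA : IsLagrangian ω A) (hM : IsLagrangian ω M)
    (hM' : IsLagrangian ω M') (hAM : IsCompl A M) (hAM' : IsCompl A M') :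
    (restrictForm ω (A.projection M hAM) M').radical = M.comap M'.subtype := by
  set p := A.projection M hAM with hp
  have hsymm : ∀ x y : M', ω (p y) x = ω (p x) y := fun x y => by
    have hpA : ∀ y, p y ∈ A := fun y => Submodule.projection_apply_mem hAM y
    have hpM : ∀ y, y - p y ∈ M := fun y => Submodule.sub_projection_mem hAM y
    have h1 := hM'.apply_eq_zero x x.2 y y.2
    have h2 := hA.apply_eq_zero _ (hpA x) _ (hpA y)
    have h3 := hM.apply_eq_zero _ (hpM x) _ (hpM y)
    have h4 := halt.neg (p y) x
    simp only [map_sub, LinearMap.sub_apply] at h3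
    linarith
  rw [QuadraticMap.radical_eq_ker_polarBilin]
  ext x
  have hpolar : ∀ y : M', QuadraticMap.polar (restrictForm ω p M') x y = 2 * ω (p x) y := by
    intro y
    simp only [QuadraticMap.polar, restrictForm_apply, Submodule.coe_add, map_add,
      LinearMap.add_apply, hsymm x y]
    ring
  simp only [LinearMap.mem_ker, LinearMap.ext_iff, QuadraticMap.polarBilin_apply_apply,
    LinearMap.zero_apply, hpolar, Submodule.mem_comap, Submodule.subtype_apply]
  rw [← Submodule.projection_apply_eq_zero_iff hAM]
  constructor
  · intro h
    have h1 : p x ∈ M' := hM'.mem_of_apply_eq_zero fun y hy => by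
      have h2 := h ⟨y, hy⟩
      have h3 := halt.neg y (p x)
      simp only at h2
      linarith
    exact Submodule.disjoint_def.1 hAM'.disjoint _ (Submodule.projection_apply_mem hAM _) h1
  · intro h y
    rw [← hp] at h
    simp [h]

variable [FiniteDimensional ℝ E]

lemma IsLagrangian.isCompl {ω : BilinForm ℝ E} (hnd : LinearMap.BilinForm.Nondegenerate ω)
    {L M : Submodule ℝ E} (hL : IsLagrangian ω L) (hM : IsLagrangian ω M) (h : M ⊓ L = ⊥) :
    IsCompl L M := by
  have h1 := LinearMap.BilinForm.finrank_orthogonal hnd L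
  have h2 := LinearMap.BilinForm.finrank_orthogonal hnd M
  rw [hL] at h1
  rw [hM] at h2
  have h3 := L.finrank_le
  have h4 := M.finrank_le
  refine (Submodule.isCompl_iff_disjoint _ _ (by omega)).2 ?_
  rw [disjoint_iff, inf_comm, h]

lemma formSig_restrictForm_add {ω : BilinForm ℝ E} (halt : LinearMap.IsAlt ω)
    {A X M M' : Submodule ℝ E} (hA : IsLagrangian ω A) (hX : IsLagrangian ω X)
    (hM : IsLagrangian ω M) (hM' : IsLagrangian ω M') (hAM : IsCompl A M) (hAM' : IsCompl A M')
    (hXM : IsCompl X M) :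
    formSig (restrictForm ω (A.projection M hAM) X) +
        formSig (restrictForm ω (X.projection M hXM) M') =
      formSig (restrictForm ω (A.projection M hAM) M') +
        formSig (restrictForm ω (A.projection M' hAM') X) := by
  set p := A.projection M hAM with hp
  set z := X.projectionOnto M hXM ∘ₗ M'.subtype with hz
  set w := M'.projectionOnto A hAM'.symm ∘ₗ X.subtype with hw
  let e₁ : (X × M') ≃ₗ[ℝ] X × M' :=
    { toFun := fun v => (v.1 + z v.2, v.2)
      invFun := fun v => (v.1 - z v.2, v.2)
      map_add' := fun u v => by
        ext <;> simp
        abel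
      map_smul' := fun c v => by
        ext <;> simp
      left_inv := fun v => by simp
      right_inv := fun v => by simp }
  let e₂ : (X × M') ≃ₗ[ℝ] M' × X :=
    { toFun := fun v => (v.2 + w v.1, v.1)
      invFun := fun v => (v.2, v.1 - w v.2)
      map_add' := fun u v => by
        ext <;> simp
        abel
      map_smul' := fun c v => by
        ext <;> simp
      left_inv := fun v => by simp
      right_inv := fun v => by simp }
  rw [← formSig_prod, ← formSig_prod]
  refine formSig_congr (e₁.symm.trans e₂) fun v => ?_
  obtain ⟨⟨x, m⟩, rfl⟩ := e₁.surjective v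
  rw [LinearEquiv.trans_apply, LinearEquiv.symm_apply_apply]
  have he₁ : e₁ (x, m) = (x + z m, m) := rfl
  have he₂ : e₂ (x, m) = (m + w x, x) := rfl
  have hzm : X.projection M hXM m = z m := rfl
  have hwx : A.projection M' hAM' x = (x : E) - w x :=
    eq_sub_of_add_eq (Submodule.projection_add_projection_eq_self hAM' (x : E))
  rw [he₁, he₂]
  simp only [QuadraticMap.prod_apply, restrictForm_apply, hzm, hwx, Submodule.coe_add]
  have hpA : ∀ y, p y ∈ A := fun y => Submodule.projection_apply_mem hAM y
  have hpM : ∀ y, y - p y ∈ M := fun y => Submodule.sub_projection_mem hAM y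
  have hpz : p (z m) = p m := by
    have h1 : (m : E) - z m ∈ M := Submodule.sub_projection_mem hXM (m : E)
    have h2 := (Submodule.projection_apply_eq_zero_iff hAM).2 h1
    rw [map_sub, sub_eq_zero] at h2
    exact h2.symm
  have hpw : (x : E) - p x = w x - p (w x) := by
    have h1 : (x : E) - w x ∈ A := hwx ▸ Submodule.projection_apply_mem hAM' (x : E)
    have h2 := Submodule.projection_apply_of_mem_left hAM h1
    rw [map_sub] at h2
    rw [sub_eq_sub_iff_sub_eq_sub]
    exact h2.symm
  obtain ⟨xb, hxb, hx⟩ : ∃ b ∈ M, (x : E) = p x + b := ⟨_, hpM x, by abel⟩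
  obtain ⟨mb, hmb, hm⟩ : ∃ b ∈ M, (m : E) = p m + b := ⟨_, hpM m, by abel⟩
  obtain ⟨zb, hzb, hz'⟩ : ∃ b ∈ M, (z m : E) = p m + b :=
    ⟨_, hpM (z m), by rw [hpz]; abel⟩
  have hw' : (w x : E) = p (w x) + xb := by
    have : xb = x - p x := by
      nth_rw 1 [hx]
      abel
    rw [this, hpw]
    abel
  have hXX := hX.apply_eq_zero x x.2 (z m) (z m).2
  have hMM := hM'.apply_eq_zero m m.2 (w x) (w x).2
  simp only [map_add p, hpz]
  have hxa := hpA x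
  have hma := hpA m
  have hwa := hpA (w x)
  generalize p (x : E) = xa at *
  generalize p (m : E) = ma at *
  generalize p (w x : E) = wa at *
  rw [hx, hz'] at hXX
  rw [hm, hw'] at hMM
  rw [hx, hm, hz', hw']
  exact (shear_identity halt hA hM hxa hma hwa hxb hmb hzb hXX hMM).symm

lemma tripleSig_sub_tripleSig {ω : BilinForm ℝ E} (halt : LinearMap.IsAlt ω)
    {A X M M' : Submodule ℝ E} (hA : IsLagrangian ω A) (hX : IsLagrangian ω X)
    (hM : IsLagrangian ω M) (hM' : IsLagrangian ω M') (hAM : IsCompl A M) (hAM' : IsCompl A M')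
    (hXM : IsCompl X M) :
    tripleSig ω A X M - tripleSig ω A X M' =
      formSig (restrictForm ω (A.projection M hAM) M') -
        formSig (restrictForm ω (X.projection M hXM) M') := by
  have h := formSig_restrictForm_add halt hA hX hM hM' hAM hAM' hXM
  rw [tripleSig_eq_formSig_restrictForm halt X hA.apply_eq_zero hM.apply_eq_zero hAM,
    tripleSig_eq_formSig_restrictForm halt X hA.apply_eq_zero hM'.apply_eq_zero hAM']
  omega

end Lagrangian

section Continuity

open Classical in
/-- The projection onto `A` along `M` as a continuous linear map, and `0` if `A` and `M` are not
complementary. -/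
noncomputable def projAlong [FiniteDimensional ℝ E] (A M : Submodule ℝ E) : E →L[ℝ] E :=
  if h : IsCompl A M then LinearMap.toContinuousLinearMap (A.projection M h) else 0

variable [FiniteDimensional ℝ E]

lemma coe_projAlong {A M : Submodule ℝ E} (h : IsCompl A M) :
    (projAlong A M : E →ₗ[ℝ] E) = A.projection M h := by
  rw [projAlong, dif_pos h]
  rfl

lemma projAlong_apply {A M : Submodule ℝ E} (h : IsCompl A M) (x : E) :
    projAlong A M x = A.projection M h x := by
  rw [← coe_projAlong h]
  rfl

lemma IsLagrangianPath.continuousWithinAt_projAlong {ω : BilinForm ℝ E} {a b : ℝ}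
    {L : ℝ → Submodule ℝ E} (hL : IsLagrangianPath ω a b L) {M : Submodule ℝ E} {s : Set ℝ}
    (hs : s ⊆ Set.Icc a b) (hLM : ∀ t ∈ s, IsCompl (L t) M) {t₀ : ℝ} (ht₀ : t₀ ∈ s) :
    ContinuousWithinAt (fun t => projAlong (L t) M) s t₀ := by
  obtain ⟨U, hU, -, P, hP, hPL⟩ := hL.locTriv t₀ (hs ht₀)
  have hU' : U ∈ 𝓝[s] t₀ := nhdsWithin_mono _ hs hU
  have ht₀U : t₀ ∈ U := mem_of_mem_nhdsWithin (hs ht₀) hU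
  have hPc : ContinuousWithinAt P s t₀ := (hP t₀ ht₀U).mono_of_mem_nhdsWithin hU'
  have hmem : ∀ t ∈ U, ∀ x, P t x ∈ L t := fun t ht x => (hPL t ht).2 ▸ ⟨x, rfl⟩
  set p₀ := projAlong (L t₀) M with hp₀
  have hp₀_apply : ∀ x, p₀ x = (L t₀).projection M (hLM t₀ ht₀) x := projAlong_apply _
  set Φ : ℝ → E →L[ℝ] E := fun t => P t * p₀ + (1 - p₀) with hΦ
  have hΦc : ContinuousWithinAt Φ s t₀ := (hPc.mul continuousWithinAt_const).add
    continuousWithinAt_const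
  have hΦ₀ : Φ t₀ = 1 := by
    have : P t₀ * p₀ = p₀ := by
      ext x
      have hx : p₀ x ∈ L t₀ := hp₀_apply x ▸ Submodule.projection_apply_mem _ x
      rw [← (hPL t₀ ht₀U).2] at hx
      obtain ⟨y, hy⟩ := hx
      have hy' : P t₀ y = p₀ x := hy
      change P t₀ (p₀ x) = p₀ x
      rw [← hy']
      exact DFunLike.congr_fun (hPL t₀ ht₀U).1 y
    rw [hΦ]
    simp only [this]
    abel
  have hunit : ∀ᶠ t in 𝓝[s] t₀, IsUnit (Φ t) :=
    hΦc (Units.isOpen.mem_nhds (by rw [hΦ₀]; exact isUnit_one))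
  have hinv : ContinuousWithinAt (fun t => Ring.inverse (Φ t)) s t₀ := by
    have h1 : ContinuousAt Ring.inverse (Φ t₀) := by
      rw [hΦ₀]
      exact NormedRing.inverse_continuousAt (1 : (E →L[ℝ] E)ˣ)
    exact h1.comp_continuousWithinAt hΦc
  have hconj : ∀ᶠ t in 𝓝[s] t₀, projAlong (L t) M = Φ t * p₀ * Ring.inverse (Φ t) := by
    filter_upwards [hunit, hU', self_mem_nhdsWithin] with t ht htU hts
    rw [← mul_one (projAlong (L t) M), ← Ring.mul_inverse_cancel _ ht, ← mul_assoc]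
    congr 1
    ext x
    have hidem : p₀ (p₀ x) = p₀ x := by
      rw [hp₀_apply (p₀ x)]
      exact Submodule.projection_apply_of_mem_left _
        (hp₀_apply x ▸ Submodule.projection_apply_mem _ x)
    have h1 : Φ t x = P t (p₀ x) + (x - p₀ x) := rfl
    have h2 : Φ t (p₀ x) = P t (p₀ (p₀ x)) + (p₀ x - p₀ (p₀ x)) := rfl
    have h3 : x - p₀ x ∈ M := hp₀_apply x ▸ Submodule.sub_projection_mem _ x
    change projAlong (L t) M (Φ t x) = Φ t (p₀ x)
    rw [h1, h2, hidem, sub_self, add_zero, projAlong_apply (hLM t hts), map_add,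
      Submodule.projection_apply_of_mem_left _ (hmem t htU _),
      (Submodule.projection_apply_eq_zero_iff _).2 h3, add_zero]
  exact ((hΦc.mul continuousWithinAt_const).mul hinv).congr_of_eventuallyEq hconj
    (hconj.self_of_nhdsWithin ht₀)

lemma tendsto_restrictForm (ω : BilinForm ℝ E) {p : ℝ → E →L[ℝ] E} {s : Set ℝ} {t₀ : ℝ}
    (hp : ContinuousWithinAt p s t₀) (M : Submodule ℝ E) (x : M) :
    Tendsto (fun z : ℝ × M => restrictForm ω (p z.1) M z.2) (𝓝[s] t₀ ×ˢ 𝓝 x)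
      (𝓝 (restrictForm ω (p t₀) M x)) := by
  have h1 : Tendsto (fun z : ℝ × M => p z.1) (𝓝[s] t₀ ×ˢ 𝓝 x) (𝓝 (p t₀)) :=
    hp.tendsto.comp tendsto_fst
  have h2 : Tendsto (fun z : ℝ × M => (z.2 : E)) (𝓝[s] t₀ ×ˢ 𝓝 x) (𝓝 (x : E)) :=
    (continuous_subtype_val.tendsto x).comp tendsto_snd
  have h3 : Continuous fun z : (E →L[ℝ] E) × E => ω.toContinuousBilinearMap (z.1 z.2) z.2 := by
    fun_prop
  exact (h3.tendsto (p t₀, (x : E))).comp (h1.prodMk_nhds h2)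

lemma IsLagrangianPath.formSig_restrictForm_eq {ω : BilinForm ℝ E} (halt : LinearMap.IsAlt ω)
    {a b u v : ℝ} {L : ℝ → Submodule ℝ E} (hL : IsLagrangianPath ω a b L)
    {M M' : Submodule ℝ E} (hM : IsLagrangian ω M) (hM' : IsLagrangian ω M') (huv : u ≤ v)
    (hs : Set.Icc u v ⊆ Set.Icc a b) (hLM : ∀ t ∈ Set.Icc u v, IsCompl (L t) M)
    (hLM' : ∀ t ∈ Set.Icc u v, IsCompl (L t) M') :
    formSig (restrictForm ω (projAlong (L u) M) M') =
      formSig (restrictForm ω (projAlong (L v) M) M') := by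
  refine formSig_const huv (fun t => restrictForm ω (projAlong (L t) M) M')
    (fun t ht x => tendsto_restrictForm ω (hL.continuousWithinAt_projAlong hs hLM ht) M' x) ?_
  have h : ∀ t ∈ Set.Icc u v,
      (restrictForm ω (projAlong (L t) M) M').radical = M.comap M'.subtype := fun t ht => by
    rw [coe_projAlong (hLM t ht)]
    exact radical_restrictForm halt (hL.lag t (hs ht)) hM hM' (hLM t ht) (hLM' t ht)
  intro t ht t' ht'
  rw [h t ht, h t' ht']

lemma tripleSig_sub_eq {ω : BilinForm ℝ E} (halt : LinearMap.IsAlt ω)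
    (hnd : LinearMap.BilinForm.Nondegenerate ω) {a b u v : ℝ} {L₁ L₂ : ℝ → Submodule ℝ E}
    (h₁ : IsLagrangianPath ω a b L₁) (h₂ : IsLagrangianPath ω a b L₂)
    {M M' : Submodule ℝ E} (hM : IsLagrangian ω M) (hM' : IsLagrangian ω M') (huv : u ≤ v)
    (hs : Set.Icc u v ⊆ Set.Icc a b)
    (hM₁ : ∀ t ∈ Set.Icc u v, M ⊓ L₁ t = ⊥) (hM₂ : ∀ t ∈ Set.Icc u v, M ⊓ L₂ t = ⊥)
    (hM₁' : ∀ t ∈ Set.Icc u v, M' ⊓ L₁ t = ⊥) (hM₂' : ∀ t ∈ Set.Icc u v, M' ⊓ L₂ t = ⊥) :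
    tripleSig ω (L₁ u) (L₂ u) M - tripleSig ω (L₁ v) (L₂ v) M =
      tripleSig ω (L₁ u) (L₂ u) M' - tripleSig ω (L₁ v) (L₂ v) M' := by
  have c₁ := fun t ht => (h₁.lag t (hs ht)).isCompl hnd hM (hM₁ t ht)
  have c₂ := fun t ht => (h₂.lag t (hs ht)).isCompl hnd hM (hM₂ t ht)
  have c₁' := fun t ht => (h₁.lag t (hs ht)).isCompl hnd hM' (hM₁' t ht)
  have c₂' := fun t ht => (h₂.lag t (hs ht)).isCompl hnd hM' (hM₂' t ht)
  have key : ∀ t ∈ Set.Icc u v, tripleSig ω (L₁ t) (L₂ t) M - tripleSig ω (L₁ t) (L₂ t) M' =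
      formSig (restrictForm ω (projAlong (L₁ t) M) M') -
        formSig (restrictForm ω (projAlong (L₂ t) M) M') := fun t ht => by
    rw [coe_projAlong (c₁ t ht), coe_projAlong (c₂ t ht)]
    exact tripleSig_sub_tripleSig halt (h₁.lag t (hs ht)) (h₂.lag t (hs ht)) hM hM' (c₁ t ht)
      (c₁' t ht) (c₂ t ht)
  have ku := key u (Set.left_mem_Icc.2 huv)
  have kv := key v (Set.right_mem_Icc.2 huv)
  have e₁ := h₁.formSig_restrictForm_eq halt hM hM' huv hs c₁ c₁'
  have e₂ := h₂.formSig_restrictForm_eq halt hM hM' huv hs c₂ c₂'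
  omega

end Continuity

section Partition

/-- The truncation of `x` to the interval `[l, r]`. -/
noncomputable def clamp (l r x : ℝ) : ℝ := max l (min x r)

lemma clamp_of_le {l r x : ℝ} (h : x ≤ l) : clamp l r x = l :=
  max_eq_left ((min_le_left _ _).trans h)

lemma clamp_of_ge {l r x : ℝ} (hlr : l ≤ r) (h : r ≤ x) : clamp l r x = r := by
  rw [clamp, min_eq_right h, max_eq_right hlr]

/-- The endpoints of two intervals, truncated to the other interval, either coincide pairwise or
bound their common part. -/
lemma clamp_sub_clamp {l r l' r' : ℝ} (h : l ≤ r) (h' : l' ≤ r') {f g : ℝ → ℤ}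
    (hfg : ∀ u v, u ≤ v → l ≤ u → l' ≤ u → v ≤ r → v ≤ r' → f u - f v = g u - g v) :
    f (clamp l r l') - f (clamp l r r') = g (clamp l' r' l) - g (clamp l' r' r) := by
  rcases lt_or_ge r l' with h1 | h1
  · rw [clamp_of_ge h h1.le, clamp_of_ge h (h1.le.trans h'), clamp_of_le (h.trans h1.le),
      clamp_of_le h1.le, sub_self, sub_self]
  rcases lt_or_ge r' l with h2 | h2
  · rw [clamp_of_le (h'.trans h2.le), clamp_of_le h2.le, clamp_of_ge h' h2.le,
      clamp_of_ge h' (h2.le.trans h), sub_self, sub_self]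
  have e1 : clamp l r l' = max l l' := by rw [clamp, min_eq_left h1]
  have e2 : clamp l r r' = min r r' := by
    rw [clamp, min_comm, max_eq_right (le_min h h2)]
  have e3 : clamp l' r' l = max l l' := by rw [clamp, min_eq_left h2, max_comm]
  have e4 : clamp l' r' r = min r r' := by rw [clamp, max_eq_right (le_min h1 h')]
  rw [e1, e2, e3, e4]
  exact hfg _ _ (max_le (le_min h h2) (le_min h1 h')) (le_max_left _ _) (le_max_right _ _)
    (min_le_left _ _) (min_le_right _ _)

/-- Sums of increments over two partitions of `[a, b]` agree as soon as the increments agree on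
the common part of any two cells. -/
lemma sum_partition_eq {a b : ℝ} {k k' : ℕ} {t t' : ℕ → ℝ}
    (ht0 : t 0 = a) (htk : t k = b) (ht : ∀ i < k, t i ≤ t (i + 1))
    (ht0' : t' 0 = a) (htk' : t' k' = b) (ht' : ∀ i < k', t' i ≤ t' (i + 1))
    (hmem : ∀ i ≤ k, t i ∈ Set.Icc a b) (hmem' : ∀ i ≤ k', t' i ∈ Set.Icc a b)
    (f g : ℕ → ℝ → ℤ)
    (hfg : ∀ i < k, ∀ j < k', ∀ u v, u ≤ v → t i ≤ u → t' j ≤ u → v ≤ t (i + 1) →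
      v ≤ t' (j + 1) → f i u - f i v = g j u - g j v) :
    ∑ i ∈ Finset.range k, (f i (t i) - f i (t (i + 1))) =
      ∑ j ∈ Finset.range k', (g j (t' j) - g j (t' (j + 1))) := by
  have hf : ∀ i ∈ Finset.range k, f i (t i) - f i (t (i + 1)) = ∑ j ∈ Finset.range k',
      (f i (clamp (t i) (t (i + 1)) (t' j)) - f i (clamp (t i) (t (i + 1)) (t' (j + 1)))) := by
    intro i hi
    have hi := Finset.mem_range.1 hi
    rw [Finset.sum_range_sub' (fun j => f i (clamp (t i) (t (i + 1)) (t' j))), ht0', htk',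
      clamp_of_le (hmem i hi.le).1, clamp_of_ge (ht i hi) (hmem (i + 1) hi).2]
  have hg : ∀ j ∈ Finset.range k', g j (t' j) - g j (t' (j + 1)) = ∑ i ∈ Finset.range k,
      (g j (clamp (t' j) (t' (j + 1)) (t i)) - g j (clamp (t' j) (t' (j + 1)) (t (i + 1)))) := by
    intro j hj
    have hj := Finset.mem_range.1 hj
    rw [Finset.sum_range_sub' (fun i => g j (clamp (t' j) (t' (j + 1)) (t i))), ht0, htk,
      clamp_of_le (hmem' j hj.le).1, clamp_of_ge (ht' j hj) (hmem' (j + 1) hj).2]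
  rw [Finset.sum_congr rfl hf, Finset.sum_congr rfl hg, Finset.sum_comm]
  refine Finset.sum_congr rfl fun j hj => Finset.sum_congr rfl fun i hi => ?_
  have hi := Finset.mem_range.1 hi
  have hj := Finset.mem_range.1 hj
  exact clamp_sub_clamp (ht i hi) (ht' j hj) (hfg i hi j hj)

lemma AdmissibleData.t_mem_Icc {ω : BilinForm ℝ E} {a b : ℝ} {L1 L2 : ℝ → Submodule ℝ E}
    (D : AdmissibleData ω a b L1 L2) {i : ℕ} (hi : i ≤ D.k) : D.t i ∈ Set.Icc a b := by
  have hmono : ∀ i j, i ≤ j → j ≤ D.k → D.t i ≤ D.t j := by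
    intro i j hij
    induction j, hij using Nat.le_induction with
    | base => exact fun _ => le_rfl
    | succ j _ ih => exact fun hj => (ih (by omega)).trans (D.hmono j (by omega))
  exact ⟨D.ht0.symm.trans_le (hmono 0 i i.zero_le hi), (hmono i D.k hi le_rfl).trans_eq D.htk⟩

end Partition

/-- well-definedness of the intersection number: any two sets of admissible data
for a pair of continuous paths of Lagrangian subspaces give the same value of
`(1/2) Σ_ν ( s(L1(t_{ν-1}), L2(t_{ν-1}), M_ν) − s(L1(t_ν), L2(t_ν), M_ν) )`. -/
theorem intersection_number_well_defined [FiniteDimensional ℝ E]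
    (ω : BilinForm ℝ E) (halt : LinearMap.IsAlt ω)
    (hnd : LinearMap.BilinForm.Nondegenerate ω)
    (a b : ℝ) (hab : a ≤ b)
    (L1 L2 : ℝ → Submodule ℝ E)
    (h1 : IsLagrangianPath ω a b L1) (h2 : IsLagrangianPath ω a b L2)
    (D D' : AdmissibleData ω a b L1 L2) :
    dataSum D = dataSum D' := by
  have hsum := sum_partition_eq D.ht0 D.htk D.hmono D'.ht0 D'.htk D'.hmono
    (fun _ hi => D.t_mem_Icc hi) (fun _ hi => D'.t_mem_Icc hi)
    (fun ν s => tripleSig ω (L1 s) (L2 s) (D.M (ν + 1)))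
    (fun ν s => tripleSig ω (L1 s) (L2 s) (D'.M (ν + 1))) ?_
  · unfold dataSum
    congr 1
    exact_mod_cast hsum
  · intro i hi j hj u v huv hiu hju hvi hvj
    have hs : Set.Icc u v ⊆ Set.Icc (D.t i) (D.t (i + 1)) := Set.Icc_subset_Icc hiu hvi
    have hs' : Set.Icc u v ⊆ Set.Icc (D'.t j) (D'.t (j + 1)) := Set.Icc_subset_Icc hju hvj
    have hab' : Set.Icc u v ⊆ Set.Icc a b := hs.trans
      (Set.Icc_subset_Icc (D.t_mem_Icc hi.le).1 (D.t_mem_Icc hi).2)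
    exact tripleSig_sub_eq halt hnd h1 h2 (D.hlag i hi) (D'.hlag j hj) huv hab'
      (fun s h => D.htrans1 i hi s (hs h)) (fun s h => D.htrans2 i hi s (hs h))
      (fun s h => D'.htrans1 j hj s (hs' h)) (fun s h => D'.htrans2 j hj s (hs' h))
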